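/- arXiv:2408.07636 — 2 statements merged into one kernel-verified Lean document; each statement's English description precedes it below -/
import Mathlib

section
/- Let μ be a probability measure on ℝ with quantile function Q, and for N ≥ 1 let Q_N(u) = Q((2⌈Nu⌉ − 1)/(2N)) be the N-bin discretized quantile function. Let U be the uniform probability measure on (0,1). Then the pushforward measures (Q_N)_* U converge weakly (in distribution) to μ as N → ∞. -/
open MeasureTheory Set Filter

lemma quantile_le_iff (μ : Measure ℝ) [IsProbabilityMeasure μ] (u x : ℝ) (h0 : 0 < u)
    (h1 : u < 1) :
    sInf {y : ℝ | u ≤ ProbabilityTheory.cdf μ y} ≤ x ↔ u ≤ ProbabilityTheory.cdf μ x := by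
  have hne : {y : ℝ | u ≤ ProbabilityTheory.cdf μ y}.Nonempty := by
    obtain ⟨y, hy⟩ := ((ProbabilityTheory.tendsto_cdf_atTop μ).eventually
      (lt_mem_nhds h1)).exists
    exact ⟨y, hy.le⟩
  have hbdd : BddBelow {y : ℝ | u ≤ ProbabilityTheory.cdf μ y} := by
    obtain ⟨y, hy⟩ := ((ProbabilityTheory.tendsto_cdf_atBot μ).eventually
      (gt_mem_nhds h0)).exists
    refine ⟨y, fun z hz => ?_⟩
    by_contra hlt
    have := ProbabilityTheory.monotone_cdf μ (not_le.1 hlt).le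
    have hz' : u ≤ ProbabilityTheory.cdf μ z := hz
    linarith
  constructor
  · intro h
    have hr : ContinuousWithinAt (ProbabilityTheory.cdf μ) (Ioi x) x :=
      ((ProbabilityTheory.cdf μ).right_continuous x).mono Ioi_subset_Ici_self
    refine ge_of_tendsto hr ?_
    filter_upwards [self_mem_nhdsWithin] with y hy
    obtain ⟨z, hz, hzy⟩ := exists_lt_of_csInf_lt hne (lt_of_le_of_lt h hy)
    exact le_trans hz (ProbabilityTheory.monotone_cdf μ hzy.le)
  · intro h
    exact csInf_le hbdd h

theorem discretized_quantile_pushforward_tendsto_weakly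
    (μ : Measure ℝ) [IsProbabilityMeasure μ]
    (F : ℝ → ℝ) (hF : ∀ x, F x = (μ (Iic x)).toReal)
    (Q : ℝ → ℝ) (hQ : ∀ u, Q u = sInf {x : ℝ | u ≤ F x})
    (QN : ℕ → ℝ → ℝ)
    (hQN : ∀ N : ℕ, 1 ≤ N → ∀ u : ℝ,
      QN N u = Q ((2 * (⌈(N : ℝ) * u⌉ : ℝ) - 1) / (2 * N))) :
    ∀ f : BoundedContinuousFunction ℝ ℝ,
      Tendsto (fun N => ∫ x, f x ∂((volume.restrict (Ioo (0:ℝ) 1)).map (QN N)))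
        atTop (nhds (∫ x, f x ∂μ)) := by
  intro f
  have hFc : F = ProbabilityTheory.cdf μ := by
    funext x
    rw [hF, ProbabilityTheory.cdf_eq_real]; rfl
  have gal : ∀ u ∈ Ioo (0:ℝ) 1, ∀ x, Q u ≤ x ↔ u ≤ F x := by
    intro u hu x
    rw [hQ, hFc]
    exact quantile_le_iff μ u x hu.1 hu.2
  have hmono : MonotoneOn Q (Ioo 0 1) := by
    intro u hu v hv huv
    rw [gal u hu]
    exact huv.trans ((gal v hv _).1 le_rfl)
  have hQm : AEMeasurable Q (volume.restrict (Ioo (0:ℝ) 1)) :=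
    aemeasurable_restrict_of_monotoneOn measurableSet_Ioo hmono
  have hQNm : ∀ N : ℕ, 1 ≤ N → Measurable (QN N) := by
    intro N hN
    have : QN N = (fun k : ℤ => Q ((2 * (k : ℝ) - 1) / (2 * N))) ∘
        (fun u : ℝ => ⌈(N : ℝ) * u⌉) := by
      funext u; exact hQN N hN u
    rw [this]
    exact (measurable_from_top).comp (Int.measurable_ceil.comp (measurable_const_mul _))
  have hmap : (volume.restrict (Ioo (0:ℝ) 1)).map Q = μ := by
    have : IsFiniteMeasure ((volume.restrict (Ioo (0:ℝ) 1)).map Q) := inferInstance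
    refine Measure.ext_of_Iic _ _ fun x => ?_
    rw [Measure.map_apply_of_aemeasurable hQm measurableSet_Iic,
      Measure.restrict_apply₀' measurableSet_Ioo.nullMeasurableSet]
    have hx : μ (Iic x) = ENNReal.ofReal (F x) := by
      rw [hF, ENNReal.ofReal_toReal (measure_ne_top _ _)]
    have hF1 : F x ≤ 1 := by rw [hFc]; exact ProbabilityTheory.cdf_le_one μ x
    rw [hx]
    apply le_antisymm
    · calc _ ≤ volume (Ioc 0 (F x)) := measure_mono fun u hu =>
            ⟨hu.2.1, (gal u hu.2 x).1 hu.1⟩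
        _ = _ := by simp
    · calc _ = volume (Ioo 0 (F x)) := by simp
        _ ≤ _ := measure_mono fun u hu => by
            have hu' : u ∈ Ioo (0:ℝ) 1 := ⟨hu.1, hu.2.trans_le hF1⟩
            exact ⟨(gal u hu' x).2 hu.2.le, hu'⟩
  have hlim : ∫ x, f x ∂μ = ∫ u in Ioo (0:ℝ) 1, f (Q u) := by
    conv_lhs => rw [← hmap]
    exact integral_map hQm f.continuous.aestronglyMeasurable
  rw [hlim]
  have hev : ∀ᶠ N : ℕ in atTop, ∫ u in Ioo (0:ℝ) 1, f (QN N u) =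
      ∫ x, f x ∂((volume.restrict (Ioo (0:ℝ) 1)).map (QN N)) := by
    filter_upwards [eventually_ge_atTop 1] with N hN
    exact (integral_map (hQNm N hN).aemeasurable f.continuous.aestronglyMeasurable).symm
  refine Tendsto.congr' hev ?_
  refine tendsto_integral_filter_of_dominated_convergence (fun _ => ‖f‖) ?_ ?_ ?_ ?_
  · filter_upwards [eventually_ge_atTop 1] with N hN
    exact (f.continuous.measurable.comp (hQNm N hN)).aestronglyMeasurable
  · exact Eventually.of_forall fun N => Eventually.of_forall fun u => f.norm_coe_le_norm _
  · exact integrable_const _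
  · have hc := hmono.countable_not_continuousWithinAt
    have hae : ∀ᵐ u ∂(volume.restrict (Ioo (0:ℝ) 1)),
        u ∉ {x ∈ Ioo (0:ℝ) 1 | ¬ContinuousWithinAt Q (Ioo 0 1) x} :=
      hc.ae_notMem _
    filter_upwards [hae, ae_restrict_mem measurableSet_Ioo] with u hu hu01
    have hcont : ContinuousAt Q u := by
      have : ContinuousWithinAt Q (Ioo 0 1) u := by
        by_contra h
        exact hu ⟨hu01, h⟩
      exact this.continuousAt (Ioo_mem_nhds hu01.1 hu01.2)
    have hseq : Tendsto (fun N : ℕ => (2 * (⌈(N : ℝ) * u⌉ : ℝ) - 1) / (2 * N)) atTop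
        (nhds u) := by
      have h1 : Tendsto (fun N : ℕ => u - 1 / (N : ℝ)) atTop (nhds u) := by
        simpa using tendsto_const_nhds.sub (tendsto_one_div_atTop_nhds_zero_nat (𝕜 := ℝ))
      have h2 : Tendsto (fun N : ℕ => u + 1 / (N : ℝ)) atTop (nhds u) := by
        simpa using tendsto_const_nhds.add (tendsto_one_div_atTop_nhds_zero_nat (𝕜 := ℝ))
      refine tendsto_of_tendsto_of_tendsto_of_le_of_le' h1 h2 ?_ ?_
      · filter_upwards [eventually_ge_atTop 1] with N hN
        have hN' : (0:ℝ) < N := by exact_mod_cast hN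
        have := Int.le_ceil ((N : ℝ) * u)
        rw [le_div_iff₀ (by positivity)]
        have e : (u - 1 / (N:ℝ)) * (2 * N) = 2 * (N * u) - 2 := by field_simp
        rw [e]; linarith
      · filter_upwards [eventually_ge_atTop 1] with N hN
        have hN' : (0:ℝ) < N := by exact_mod_cast hN
        have := Int.ceil_lt_add_one ((N : ℝ) * u)
        rw [div_le_iff₀ (by positivity)]
        have e : (u + 1 / (N:ℝ)) * (2 * N) = 2 * (N * u) + 2 := by field_simp
        rw [e]; linarith
    refine ((f.continuous.tendsto _).comp (hcont.tendsto.comp hseq)).congr' ?_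
    filter_upwards [eventually_ge_atTop 1] with N hN
    simp [hQN N hN]
end

section
/- (Distributional form of Theorem 3.1: Discrete Local Gaussian sampling converges to the true distribution.) Let μ be a probability measure on ℝ with quantile function Q, let σ ≥ 0, and for N ≥ 1 let Q_N(u) = Q((2⌈Nu⌉ − 1)/(2N)) be the N-bin discretized quantile function and let U be the uniform probability measure on (0,1). Define the Discrete Local Gaussian sampling distribution φ_N = ((Q_N)_* U) ∗ gaussianReal 0 (σ/N²), i.e. the law of Q_N(U') + Z_N where U' ∼ Uniform(0,1) and Z_N ∼ N(0, σ/N²) are independent. Then φ_N converges weakly (in distribution) to μ as N → ∞. -/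
open MeasureTheory Set Filter ProbabilityTheory

lemma dlg_galois (μ : Measure ℝ) [IsProbabilityMeasure μ]
    (F : ℝ → ℝ) (hF : ∀ x, F x = (μ (Iic x)).toReal)
    (Q : ℝ → ℝ) (hQ : ∀ u, Q u = sInf {x : ℝ | u ≤ F x})
    (u : ℝ) (hu : u ∈ Ioo (0:ℝ) 1) (x : ℝ) : Q u ≤ x ↔ u ≤ F x := by
  have hFc : F = cdf μ := by
    ext y
    rw [hF, cdf_eq_real]; rfl
  have hmono : Monotone F := by rw [hFc]; exact monotone_cdf μ
  have hne : {x : ℝ | u ≤ F x}.Nonempty := by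
    have h := (tendsto_cdf_atTop μ).eventually (lt_mem_nhds hu.2)
    obtain ⟨y, hy⟩ := h.exists
    exact ⟨y, by rw [hFc]; exact hy.le⟩
  have hbdd : BddBelow {x : ℝ | u ≤ F x} := by
    have h := (tendsto_cdf_atBot μ).eventually (gt_mem_nhds hu.1)
    obtain ⟨y, hy⟩ := h.exists
    refine ⟨y, fun z hz => ?_⟩
    by_contra hlt
    push Not at hlt
    have h1 := hmono hlt.le
    rw [hFc] at h1 hz
    have h2 : u ≤ cdf μ z := hz
    linarith
  constructor
  · intro h
    refine le_trans ?_ (hmono h)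
    have hr : Tendsto F (nhdsWithin (Q u) (Ioi (Q u))) (nhds (F (Q u))) := by
      have := (cdf μ).right_continuous (Q u)
      rw [hFc]
      exact this.mono_left (nhdsWithin_mono _ Ioi_subset_Ici_self)
    refine ge_of_tendsto hr ?_
    filter_upwards [self_mem_nhdsWithin] with y hy
    have hy' : sInf {x : ℝ | u ≤ F x} < y := by rw [← hQ]; exact hy
    obtain ⟨s, hs, hsy⟩ := exists_lt_of_csInf_lt hne hy'
    exact le_trans hs (hmono hsy.le)
  · intro h
    rw [hQ]
    exact csInf_le hbdd h

lemma dlg_monotoneOn (μ : Measure ℝ) [IsProbabilityMeasure μ]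
    (F : ℝ → ℝ) (hF : ∀ x, F x = (μ (Iic x)).toReal)
    (Q : ℝ → ℝ) (hQ : ∀ u, Q u = sInf {x : ℝ | u ≤ F x}) :
    MonotoneOn Q (Ioo (0:ℝ) 1) := by
  intro u hu v hv huv
  rw [dlg_galois μ F hF Q hQ u hu]
  exact huv.trans ((dlg_galois μ F hF Q hQ v hv _).1 le_rfl)

lemma dlg_map (μ : Measure ℝ) [IsProbabilityMeasure μ]
    (F : ℝ → ℝ) (hF : ∀ x, F x = (μ (Iic x)).toReal)
    (Q : ℝ → ℝ) (hQ : ∀ u, Q u = sInf {x : ℝ | u ≤ F x})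
    (hm : AEMeasurable Q (volume.restrict (Ioo (0:ℝ) 1))) :
    (volume.restrict (Ioo (0:ℝ) 1)).map Q = μ := by
  refine Measure.ext_of_Iic _ _ fun x => ?_
  rw [Measure.map_apply_of_aemeasurable hm measurableSet_Iic,
    Measure.restrict_apply' measurableSet_Ioo]
  have h1 : Q ⁻¹' Iic x ∩ Ioo 0 1 = Ioc 0 (F x) ∩ Ioo 0 1 := by
    ext u
    simp only [mem_inter_iff, mem_preimage, mem_Iic, mem_Ioc]
    constructor
    · rintro ⟨h, hu⟩
      exact ⟨⟨hu.1, (dlg_galois μ F hF Q hQ u hu x).1 h⟩, hu⟩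
    · rintro ⟨h, hu⟩
      exact ⟨(dlg_galois μ F hF Q hQ u hu x).2 h.2, hu⟩
  have hF1 : F x ≤ 1 := by
    rw [hF]; exact measureReal_le_one
  have h2 : volume (Ioc 0 (F x) ∩ Ioo 0 1) = volume (Ioc 0 (F x)) := by
    have e : (Ioo (0:ℝ) 1 : Set ℝ) =ᵐ[volume] Ioc 0 1 := Ioo_ae_eq_Ioc
    rw [measure_congr ((ae_eq_refl (Ioc 0 (F x))).inter e), inter_eq_left.2]
    exact Ioc_subset_Ioc_right hF1
  rw [h1, h2, Real.volume_Ioc, sub_zero, hF, ENNReal.ofReal_toReal (measure_ne_top _ _)]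

lemma dlg_gauss (σ : NNReal) (N : ℕ) :
    gaussianReal 0 (σ / (N : NNReal) ^ 2)
      = (gaussianReal 0 1).map (fun z => (√(σ:ℝ) / N) * z) := by
  rw [gaussianReal_map_const_mul]
  congr 1
  · simp
  · ext
    simp [div_pow]

lemma dlg_tendsto (u : ℝ) :
    Tendsto (fun N : ℕ => (2 * (⌈(N : ℝ) * u⌉ : ℝ) - 1) / (2 * N)) atTop (nhds u) := by
  have h0 : Tendsto (fun N : ℕ => (1 / 2 : ℝ) / N) atTop (nhds 0) :=
    tendsto_const_div_atTop_nhds_zero_nat _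
  have hl : Tendsto (fun N : ℕ => u - (1 / 2 : ℝ) / N) atTop (nhds u) := by
    simpa using tendsto_const_nhds.sub h0
  have hr : Tendsto (fun N : ℕ => u + (1 / 2 : ℝ) / N) atTop (nhds u) := by
    simpa using tendsto_const_nhds.add h0
  refine tendsto_of_tendsto_of_tendsto_of_le_of_le' hl hr ?_ ?_
  · filter_upwards [eventually_ge_atTop 1] with N hN
    have hN' : (0:ℝ) < N := by exact_mod_cast hN
    rw [le_div_iff₀ (by positivity)]
    have := Int.le_ceil ((N:ℝ) * u)
    have e : (u - 1 / 2 / (N:ℝ)) * (2 * N) = 2 * (N * u) - 1 := by field_simp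
    linarith
  · filter_upwards [eventually_ge_atTop 1] with N hN
    have hN' : (0:ℝ) < N := by exact_mod_cast hN
    rw [div_le_iff₀ (by positivity)]
    have := Int.ceil_lt_add_one ((N:ℝ) * u)
    have e : (u + 1 / 2 / (N:ℝ)) * (2 * N) = 2 * (N * u) + 1 := by field_simp
    linarith

/-- Discrete Local Gaussian sampling converges in distribution to the true distribution:
with `Q_N` the `N`-bin discretized quantile function of `μ`, `U` the uniform measure on
`(0,1)`, and `φ_N = ((Q_N)_* U) ∗ N(0, σ/N²)`, the measures `φ_N` converge weakly to `μ`. -/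
theorem dlg_sampling_tendsto_weakly
    (μ : Measure ℝ) [IsProbabilityMeasure μ] (σ : NNReal)
    (F : ℝ → ℝ) (hF : ∀ x, F x = (μ (Iic x)).toReal)
    (Q : ℝ → ℝ) (hQ : ∀ u, Q u = sInf {x : ℝ | u ≤ F x})
    (QN : ℕ → ℝ → ℝ)
    (hQN : ∀ N : ℕ, 1 ≤ N → ∀ u : ℝ,
      QN N u = Q ((2 * (⌈(N : ℝ) * u⌉ : ℝ) - 1) / (2 * N)))
    (φ : ℕ → Measure ℝ)
    (hφ : ∀ N : ℕ, 1 ≤ N →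
      φ N = Measure.map (fun p : ℝ × ℝ => p.1 + p.2)
        (((volume.restrict (Ioo (0:ℝ) 1)).map (QN N)).prod
          (gaussianReal 0 (σ / (N : NNReal) ^ 2)))) :
    ∀ f : BoundedContinuousFunction ℝ ℝ,
      Tendsto (fun N => ∫ x, f x ∂(φ N)) atTop (nhds (∫ x, f x ∂μ)) := by
  intro f
  have hmono := dlg_monotoneOn μ F hF Q hQ
  have hm : AEMeasurable Q (volume.restrict (Ioo (0:ℝ) 1)) :=
    aemeasurable_restrict_of_monotoneOn measurableSet_Ioo hmono
  have hmap := dlg_map μ F hF Q hQ hm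
  set U : Measure ℝ := volume.restrict (Ioo (0:ℝ) 1) with hU
  haveI : IsProbabilityMeasure U := ⟨by simp [hU]⟩
  have hcont : ∀ᵐ u ∂U, ContinuousAt Q u := by
    have hc := hmono.countable_not_continuousWithinAt
    have h1 : ∀ᵐ u ∂U, u ∈ Ioo (0:ℝ) 1 := ae_restrict_mem measurableSet_Ioo
    have h2 := hc.ae_notMem U
    filter_upwards [h1, h2] with u hu hn
    have : ContinuousWithinAt Q (Ioo 0 1) u := by
      by_contra h
      exact hn ⟨hu, h⟩
    exact this.continuousAt (Ioo_mem_nhds hu.1 hu.2)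
  have hQNm : ∀ N : ℕ, 1 ≤ N → Measurable (QN N) := by
    intro N hN
    have e : QN N = (fun k : ℤ => Q ((2 * (k : ℝ) - 1) / (2 * N))) ∘
        (fun u : ℝ => ⌈(N : ℝ) * u⌉) := by
      ext u
      exact hQN N hN u
    rw [e]
    exact (measurable_of_countable _).comp (Int.measurable_ceil.comp (measurable_const_mul _))
  have hint : ∀ N : ℕ, 1 ≤ N → ∫ x, f x ∂(φ N) =
      ∫ p, f (QN N p.1 + (√(σ:ℝ) / N) * p.2) ∂(U.prod (gaussianReal 0 1)) := by
    intro N hN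
    have hmz : Measurable (fun z : ℝ => (√(σ:ℝ) / N) * z) := measurable_const_mul _
    rw [hφ N hN, dlg_gauss, Measure.map_prod_map U _ (hQNm N hN) hmz,
      Measure.map_map (by fun_prop) (by have := hQNm N hN; fun_prop),
      integral_map (by have := hQNm N hN; fun_prop) f.continuous.aestronglyMeasurable]
    rfl
  have hlim : ∫ x, f x ∂μ = ∫ p, f (Q p.1) ∂(U.prod (gaussianReal 0 1)) := by
    rw [integral_fun_fst (fun x => f (Q x))]
    conv_lhs => rw [← hmap]
    rw [integral_map hm f.continuous.aestronglyMeasurable]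
    simp
  rw [hlim]
  refine Tendsto.congr' (f₁ := fun N : ℕ =>
      ∫ p, f (QN N p.1 + (√(σ:ℝ) / N) * p.2) ∂(U.prod (gaussianReal 0 1))) ?_ ?_
  · filter_upwards [eventually_ge_atTop 1] with N hN
    exact (hint N hN).symm
  refine tendsto_integral_filter_of_dominated_convergence (fun _ => ‖f‖) ?_ ?_
    (integrable_const _) ?_
  · filter_upwards [eventually_ge_atTop 1] with N hN
    have := hQNm N hN
    exact (f.continuous.measurable.comp (by fun_prop)).aestronglyMeasurable
  · exact Eventually.of_forall fun N => Eventually.of_forall fun p => f.norm_coe_le_norm _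
  · have h1 : ∀ᵐ p ∂(U.prod (gaussianReal 0 1)), ContinuousAt Q p.1 :=
      Measure.quasiMeasurePreserving_fst.ae hcont
    filter_upwards [h1] with p hp
    refine (f.continuous.tendsto _).comp ?_
    have hz : Tendsto (fun N : ℕ => (√(σ:ℝ) / N) * p.2) atTop (nhds 0) := by
      simpa using (tendsto_const_div_atTop_nhds_zero_nat (√(σ:ℝ))).mul_const p.2
    have hq : Tendsto (fun N : ℕ => QN N p.1) atTop (nhds (Q p.1)) := by
      refine (hp.tendsto.comp (dlg_tendsto p.1)).congr' ?_
      filter_upwards [eventually_ge_atTop 1] with N hN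
      exact (hQN N hN p.1).symm
    simpa using hq.add hz
end
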